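/- arXiv:2411.10889 — 7 statements merged into one kernel-verified Lean document; each statement's English description precedes it below -/
import Mathlib

section
/- Let n ≥ 1 and let G be a symmetric real n×n matrix all of whose row sums are zero (equivalently G·𝟙 = 0, where 𝟙 is the all-ones vector). Define the matrix M by M_{ij} := G_{ii} + G_{jj} − 2·G_{ij}. Then −(1/2)·C·M·C = G. -/
open Matrix BigOperators

/-- The all-ones matrix. -/
def Jmat (n : ℕ) : Matrix (Fin n) (Fin n) ℝ := Matrix.of fun _ _ => (1 : ℝ)

/-- The centering matrix `C = I - (1/n) J`. -/
noncomputable def Cmat (n : ℕ) : Matrix (Fin n) (Fin n) ℝ :=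
  (1 : Matrix (Fin n) (Fin n) ℝ) - ((1 : ℝ) / n) • Jmat n

theorem Jmat_eq_vecMulVec (n : ℕ) : Jmat n = vecMulVec (fun _ => 1) (fun _ => 1) := by
  ext i j
  simp [Jmat, vecMulVec_apply]

theorem Cmat_mulVec_one {n : ℕ} (hn : 1 ≤ n) : Cmat n *ᵥ (fun _ => (1 : ℝ)) = 0 := by
  have hn0 : (n : ℝ) ≠ 0 := by positivity
  ext i
  simp [Cmat, Jmat, mulVec, dotProduct, one_apply, hn0]

theorem Cmat_transpose (n : ℕ) : (Cmat n)ᵀ = Cmat n := by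
  ext i j
  simp [Cmat, Jmat, one_apply, eq_comm]

theorem one_vecMul_Cmat {n : ℕ} (hn : 1 ≤ n) : (fun _ => (1 : ℝ)) ᵥ* Cmat n = 0 := by
  rw [← Cmat_transpose, vecMul_transpose, Cmat_mulVec_one hn]

theorem mul_Cmat_of_mulVec_one {n : ℕ} {G : Matrix (Fin n) (Fin n) ℝ}
    (h : G *ᵥ (fun _ => (1 : ℝ)) = 0) : G * Cmat n = G := by
  simp [Cmat, Jmat_eq_vecMulVec, mul_sub, mul_vecMulVec, h]

theorem Cmat_mul_of_one_vecMul {n : ℕ} {G : Matrix (Fin n) (Fin n) ℝ}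
    (h : (fun _ => (1 : ℝ)) ᵥ* G = 0) : Cmat n * G = G := by
  simp [Cmat, Jmat_eq_vecMulVec, sub_mul, vecMulVec_mul, h]

theorem gram_from_squared_distance (n : ℕ) (hn : 1 ≤ n)
    (G : Matrix (Fin n) (Fin n) ℝ) (hsymm : G.IsSymm)
    (hcenter : G *ᵥ (fun _ => (1 : ℝ)) = 0) :
    (-(1 / 2) : ℝ) • (Cmat n * (Matrix.of fun i j => G i i + G j j - 2 * G i j) * Cmat n)
      = G := by
  have hM : (Matrix.of fun i j => G i i + G j j - 2 * G i j) =
      vecMulVec G.diag (fun _ => 1) + vecMulVec (fun _ => 1) G.diag - (2 : ℝ) • G := by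
    ext i j
    simp [vecMulVec_apply]
  have hleft : (fun _ => (1 : ℝ)) ᵥ* G = 0 := by
    rw [← hsymm.eq, vecMul_transpose, hcenter]
  rw [hM, mul_sub, mul_add, sub_mul, add_mul, mul_assoc, vecMulVec_mul, one_vecMul_Cmat hn,
    mul_vecMulVec _ (fun _ => (1 : ℝ)), Cmat_mulVec_one hn, mul_smul_comm, smul_mul_assoc,
    Cmat_mul_of_one_vecMul hleft, mul_Cmat_of_mulVec_one hcenter]
  simp [smul_smul]
end

section
/- Let n ≥ 1, let D be a symmetric real n×n matrix with zero diagonal, and suppose U is an orthogonal n×n matrix and λ : Fin n → ℝ satisfy −(1/2)·C·D·C = U·diag(λ)·Uᵀ. Let W ⊆ Fin n, define λ^W by λ^W_i = λ_i if i ∈ W and λ^W_i = 0 otherwise, and let λ̄ := λ − λ^W. Define the reconstructed Gram matrix B̂ := U·diag(λ^W)·Uᵀ and the reconstructed dissimilarity matrix D̂ by D̂_{ij} := B̂_{ii} + B̂_{jj} − 2·B̂_{ij}. Then ‖D̂ − D‖_F² = C₁ + C₂ + C₃, where C₁ = 4·Σ_{i∉W} λ_i², C₂ = 4·(Σ_{i∉W}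 λ_i)², and C₃ = 2n·‖(U⊙U)·λ̄‖² − C₂/2. -/
open Matrix BigOperators

/-- Double centering subtracts the row and column means and adds back the grand mean. -/
theorem Cmat_mul_mul_Cmat_apply {n : ℕ} (D : Matrix (Fin n) (Fin n) ℝ) (i j : Fin n) :
    (Cmat n * D * Cmat n) i j =
      D i j - (1 / n) * ∑ k, D k j - (1 / n) * ∑ k, D i k +
        (1 / n) * ((1 / n) * ∑ k, ∑ m, D m k) := by
  have h : Cmat n * D * Cmat n = D - ((1 : ℝ) / n) • (Jmat n * D) - ((1 : ℝ) / n) • (D * Jmat n) +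
      ((1 : ℝ) / n) • (((1 : ℝ) / n) • (Jmat n * D * Jmat n)) := by
    simp only [Cmat, sub_mul, mul_sub, one_mul, mul_one, smul_mul_assoc, mul_smul_comm, smul_sub]
    abel
  rw [h]
  simp [Jmat, mul_apply]

/-- A hollow symmetric matrix is recovered from its doubly centered Gram matrix. -/
theorem gram_dissimilarity_eq {n : ℕ} {D : Matrix (Fin n) (Fin n) ℝ}
    (hsymm : D.IsSymm) (hhollow : ∀ i, D i i = 0) {B : Matrix (Fin n) (Fin n) ℝ}
    (hB : (-(1 / 2) : ℝ) • (Cmat n * D * Cmat n) = B) (i j : Fin n) :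
    B i i + B j j - 2 * B i j = D i j := by
  have hrow (i : Fin n) : ∑ k, D i k = ∑ k, D k i :=
    Finset.sum_congr rfl fun k _ => hsymm.apply k i
  subst hB
  simp only [Matrix.smul_apply, smul_eq_mul, Cmat_mul_mul_Cmat_apply, hhollow, hrow]
  ring

theorem diagonal_mulVec_eq_zero_of_conj {n : ℕ} {U : Matrix (Fin n) (Fin n) ℝ}
    (hU : U * Uᵀ = 1) {l v : Fin n → ℝ} (h : (U * diagonal l * Uᵀ) *ᵥ v = 0) (j : Fin n) :
    l j * (Uᵀ *ᵥ v) j = 0 := by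
  have hU' : Uᵀ * U = 1 := mul_eq_one_comm.mp hU
  have h2 : Uᵀ *ᵥ ((U * diagonal l * Uᵀ) *ᵥ v) = diagonal l *ᵥ (Uᵀ *ᵥ v) := by
    simp only [mulVec_mulVec, ← Matrix.mul_assoc, hU', Matrix.one_mul]
  rw [h, mulVec_zero] at h2
  rw [← mulVec_diagonal, ← h2, Pi.zero_apply]

/-- The squared Frobenius norm of the dissimilarity matrix of a Gram matrix with zero row and
column sums. -/
theorem sum_sq_gram_dissimilarity {n : ℕ} {E : Matrix (Fin n) (Fin n) ℝ}
    (hrow : ∀ i, ∑ j, E i j = 0) (hcol : ∀ j, ∑ i, E i j = 0) :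
    ∑ i, ∑ j, (E i i + E j j - 2 * E i j) ^ 2 =
      4 * ∑ i, ∑ j, E i j ^ 2 + 2 * (∑ i, E i i) ^ 2 + 2 * n * ∑ i, E i i ^ 2 := by
  have hexp (i j : Fin n) : (E i i + E j j - 2 * E i j) ^ 2 =
      E i i ^ 2 + E j j ^ 2 + 2 * (E i i * E j j) + 4 * E i j ^ 2 - 4 * (E i i * E i j)
        - 4 * (E j j * E i j) := by ring
  have hr : ∑ i, ∑ j, E i i * E i j = 0 := by simp [← Finset.mul_sum, hrow]
  have hc : ∑ i, ∑ j, E j j * E i j = 0 := by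
    rw [Finset.sum_comm]
    simp [← Finset.mul_sum, hcol]
  have ht : ∑ i, ∑ j, E i i * E j j = (∑ i, E i i) ^ 2 := by
    rw [sq, Finset.sum_mul_sum]
  simp only [hexp, Finset.sum_add_distrib, Finset.sum_sub_distrib, ← Finset.mul_sum] at hr hc ht ⊢
  simp only [hr, hc, ht, Finset.sum_const, Finset.card_univ, Fintype.card_fin, nsmul_eq_mul,
    ← Finset.mul_sum]
  ring

theorem sum_sq_conj_diagonal {n : ℕ} {U : Matrix (Fin n) (Fin n) ℝ}
    (hU : U * Uᵀ = 1) (l : Fin n → ℝ) :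
    ∑ i, ∑ j, (U * diagonal l * Uᵀ) i j ^ 2 = ∑ i, l i ^ 2 := by
  have hU' : Uᵀ * U = 1 := mul_eq_one_comm.mp hU
  calc ∑ i, ∑ j, (U * diagonal l * Uᵀ) i j ^ 2
      = ((U * diagonal l * Uᵀ) * (U * diagonal l * Uᵀ)ᵀ).trace := by
        simp only [trace, diag_apply, mul_apply (N := (U * diagonal l * Uᵀ)ᵀ), transpose_apply, sq]
    _ = (U * (diagonal l * (Uᵀ * U) * diagonal l * Uᵀ)).trace := by
        simp only [transpose_mul, transpose_transpose, diagonal_transpose, Matrix.mul_assoc]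
    _ = ∑ i, l i ^ 2 := by
        rw [trace_mul_comm, hU', Matrix.mul_one, Matrix.mul_assoc, hU', Matrix.mul_one,
          diagonal_mul_diagonal, trace_diagonal]
        simp only [sq]

theorem trace_conj_diagonal {n : ℕ} {U : Matrix (Fin n) (Fin n) ℝ}
    (hU : U * Uᵀ = 1) (l : Fin n → ℝ) :
    ∑ i, (U * diagonal l * Uᵀ) i i = ∑ i, l i := by
  have hU' : Uᵀ * U = 1 := mul_eq_one_comm.mp hU
  change (U * diagonal l * Uᵀ).trace = _
  rw [Matrix.mul_assoc, trace_mul_comm, Matrix.mul_assoc, hU', Matrix.mul_one, trace_diagonal]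

theorem stress_decomposition (n : ℕ) (hn : 1 ≤ n) (D : Matrix (Fin n) (Fin n) ℝ)
    (hsymm : D.IsSymm) (hhollow : ∀ i, D i i = 0)
    (U : Matrix (Fin n) (Fin n) ℝ) (hU : U * Uᵀ = 1) (l : Fin n → ℝ)
    (hdecomp : (-(1 / 2) : ℝ) • (Cmat n * D * Cmat n) = U * Matrix.diagonal l * Uᵀ)
    (W : Finset (Fin n)) :
    let lW : Fin n → ℝ := fun i => if i ∈ W then l i else 0
    let lbar : Fin n → ℝ := fun i => l i - lW i
    let Bhat : Matrix (Fin n) (Fin n) ℝ := U * Matrix.diagonal lW * Uᵀ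
    let Dhat : Matrix (Fin n) (Fin n) ℝ :=
      Matrix.of fun i j => Bhat i i + Bhat j j - 2 * Bhat i j
    let C1 : ℝ := 4 * ∑ i ∈ Wᶜ, (l i) ^ 2
    let C2 : ℝ := 4 * (∑ i ∈ Wᶜ, l i) ^ 2
    let C3 : ℝ := 2 * n * (∑ i, (∑ j, (U i j * U i j) * lbar j) ^ 2) - C2 / 2
    ∑ i, ∑ j, (Dhat i j - D i j) ^ 2 = C1 + C2 + C3 := by
  intro lW lbar Bhat Dhat C1 C2 C3
  set B := U * diagonal l * Uᵀ with hB
  set E := U * diagonal lbar * Uᵀ with hE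
  have hEB : E = B - Bhat := by
    simp only [hE, hB, Bhat, ← Matrix.sub_mul, ← Matrix.mul_sub, diagonal_sub]
    rfl
  have hB1 : B *ᵥ (fun _ => (1 : ℝ)) = 0 := by
    rw [← hdecomp, smul_mulVec, ← mulVec_mulVec, Cmat_mulVec_one hn, mulVec_zero, smul_zero]
  have hE1 : E *ᵥ (fun _ => (1 : ℝ)) = 0 := by
    have h : diagonal lbar *ᵥ (Uᵀ *ᵥ fun _ => (1 : ℝ)) = 0 := by
      ext j
      have hj := diagonal_mulVec_eq_zero_of_conj hU hB1 j
      rw [mulVec_diagonal, Pi.zero_apply]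
      by_cases hW : j ∈ W <;> simp [lbar, lW, hW] at hj ⊢
      exact hj
    rw [hE, Matrix.mul_assoc, ← mulVec_mulVec, ← mulVec_mulVec, h, mulVec_zero]
  have hrow (i : Fin n) : ∑ j, E i j = 0 := by
    simpa [mulVec, dotProduct] using congrFun hE1 i
  have hEsymm : E.IsSymm := by
    simp [hE, IsSymm, transpose_mul, Matrix.mul_assoc]
  have hcol (j : Fin n) : ∑ i, E i j = 0 := by
    rw [← hrow j]
    exact Finset.sum_congr rfl fun i _ => hEsymm.apply j i
  have hdiag (i : Fin n) : E i i = ∑ j, (U i j * U i j) * lbar j := by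
    rw [hE, mul_apply]
    exact Finset.sum_congr rfl fun j _ => by rw [mul_diagonal, transpose_apply]; ring
  have hsum : ∑ i, lbar i = ∑ i ∈ Wᶜ, l i := by
    rw [← Finset.sum_add_sum_compl W, Finset.sum_eq_zero, zero_add]
    · exact Finset.sum_congr rfl fun i hi => by simp [lbar, lW, Finset.mem_compl.mp hi]
    · intro i hi
      simp [lbar, lW, hi]
  have hsum2 : ∑ i, lbar i ^ 2 = ∑ i ∈ Wᶜ, l i ^ 2 := by
    rw [← Finset.sum_add_sum_compl W, Finset.sum_eq_zero, zero_add]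
    · exact Finset.sum_congr rfl fun i hi => by simp [lbar, lW, Finset.mem_compl.mp hi]
    · intro i hi
      simp [lbar, lW, hi]
  have hterm (i j : Fin n) : (Dhat i j - D i j) ^ 2 = (E i i + E j j - 2 * E i j) ^ 2 := by
    rw [← gram_dissimilarity_eq hsymm hhollow hdecomp i j, hEB]
    simp only [Dhat, of_apply, Matrix.sub_apply]
    ring
  simp only [hterm]
  rw [sum_sq_gram_dissimilarity hrow hcol, sum_sq_conj_diagonal hU, trace_conj_diagonal hU,
    hsum, hsum2]
  simp only [hdiag, C1, C2, C3]
  ring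
end

section
/- Let n ≥ 1, λ : Fin n → ℝ, and W ⊆ Fin n with |W| = k. For every λ̃ : Fin n → ℝ with λ̃_i = 0 for all i ∉ W, writing Δλ := λ − λ̃, the quantity 4·Σ_i (Δλ_i)² + 4·(Σ_i Δλ_i)² is at least 4·Σ_{i∉W} λ_i² + 4·(Σ_{i∉W} λ_i)²/(1+k). Moreover, this lower bound is attained by λ̃* defined by λ̃*_i = λ_i + (Σ_{j∉W} λ_j)/(1+k) for i ∈ W and λ̃*_i = 0 for i ∉ W. -/
open BigOperators

/-- Splitting off the coordinates outside `W`, the excess of the objective over its minimum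
is a sum of squares. -/
lemma sum_sq_add_sq_sum_eq {ι : Type*} [Fintype ι] [DecidableEq ι] (l d : ι → ℝ)
    (W : Finset ι) (h : ∀ i ∉ W, d i = l i) :
    4 * ∑ i, d i ^ 2 + 4 * (∑ i, d i) ^ 2 =
      4 * ∑ i ∈ Wᶜ, l i ^ 2 + 4 * (∑ i ∈ Wᶜ, l i) ^ 2 / (1 + (W.card : ℝ)) +
        4 * ∑ i ∈ W, (d i + (∑ j ∈ Wᶜ, l j) / (1 + (W.card : ℝ))) ^ 2 +
        4 * (∑ i ∈ W, (d i + (∑ j ∈ Wᶜ, l j) / (1 + (W.card : ℝ)))) ^ 2 := by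
  have h₁ : ∑ i ∈ Wᶜ, d i = ∑ i ∈ Wᶜ, l i :=
    Finset.sum_congr rfl fun i hi => h i (Finset.mem_compl.mp hi)
  have h₂ : ∑ i ∈ Wᶜ, d i ^ 2 = ∑ i ∈ Wᶜ, l i ^ 2 :=
    Finset.sum_congr rfl fun i hi => by rw [h i (Finset.mem_compl.mp hi)]
  have hk : (1 + (W.card : ℝ)) ≠ 0 := by positivity
  rw [← Finset.sum_add_sum_compl W d, ← Finset.sum_add_sum_compl W fun i => d i ^ 2, h₁, h₂]
  simp only [add_sq, Finset.sum_add_distrib, Finset.sum_const, nsmul_eq_mul,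
    ← Finset.sum_mul, ← Finset.mul_sum]
  field_simp
  ring

theorem lower_bound_optimal_lambda (n : ℕ) (hn : 1 ≤ n) (l : Fin n → ℝ)
    (W : Finset (Fin n)) (k : ℕ) (hk : W.card = k) :
    (∀ lt : Fin n → ℝ, (∀ i ∉ W, lt i = 0) →
      4 * ∑ i, (l i - lt i) ^ 2 + 4 * (∑ i, (l i - lt i)) ^ 2
        ≥ 4 * ∑ i ∈ Wᶜ, (l i) ^ 2 + 4 * (∑ i ∈ Wᶜ, l i) ^ 2 / (1 + (k : ℝ))) ∧
    (∀ ltstar : Fin n → ℝ,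
      (ltstar = fun i =>
        if i ∈ W then l i + (∑ j ∈ Wᶜ, l j) / (1 + (k : ℝ)) else 0) →
      4 * ∑ i, (l i - ltstar i) ^ 2 + 4 * (∑ i, (l i - ltstar i)) ^ 2
        = 4 * ∑ i ∈ Wᶜ, (l i) ^ 2 + 4 * (∑ i ∈ Wᶜ, l i) ^ 2 / (1 + (k : ℝ))) := by
  subst hk
  refine ⟨fun lt hlt => ?_, fun ltstar hstar => ?_⟩
  · rw [sum_sq_add_sq_sum_eq l (fun i => l i - lt i) W fun i hi => by simp [hlt i hi],
      ge_iff_le, add_assoc]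
    exact le_add_of_nonneg_right (by positivity)
  · have hzero : ∀ i ∈ W,
        l i - ltstar i + (∑ j ∈ Wᶜ, l j) / (1 + (W.card : ℝ)) = 0 := by
      intro i hi
      simp [hstar, hi]
    have hsq : ∀ i ∈ W,
        (l i - ltstar i + (∑ j ∈ Wᶜ, l j) / (1 + (W.card : ℝ))) ^ 2 = 0 :=
      fun i hi => by rw [hzero i hi, zero_pow two_ne_zero]
    rw [sum_sq_add_sq_sum_eq l (fun i => l i - ltstar i) W fun i hi => by simp [hstar, hi],
      Finset.sum_eq_zero hzero, Finset.sum_eq_zero hsq]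
    ring
end

section
/- Let n ∈ ℕ, λ : Fin n → ℝ, and let S ⊊ Fin n be a proper finite subset (so S ≠ Fin n). Then there exists j ∉ S such that F(S ∪ {j}) ≤ F(S). (One can always add an element whose sign matches H(S), and such an addition does not increase F.) -/
open BigOperators

/-- `H(S)` is the sum of the values not selected. -/
noncomputable def Hsum {n : ℕ} (l : Fin n → ℝ) (S : Finset (Fin n)) : ℝ :=
  ∑ i ∈ Sᶜ, l i

/-- `F(S) = Σ_{i∉S} λ_i² + (H(S))²`. -/
noncomputable def Fobj {n : ℕ} (l : Fin n → ℝ) (S : Finset (Fin n)) : ℝ :=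
  ∑ i ∈ Sᶜ, (l i) ^ 2 + (Hsum l S) ^ 2

theorem Fobj_insert {n : ℕ} (l : Fin n → ℝ) {S : Finset (Fin n)} {j : Fin n} (hj : j ∉ S) :
    Fobj l (insert j S) = Fobj l S - 2 * (Hsum l S * l j) := by
  have hj' : j ∈ Sᶜ := Finset.mem_compl.2 hj
  simp only [Fobj, Hsum, Finset.compl_insert]
  rw [← Finset.add_sum_erase _ l hj', ← Finset.add_sum_erase _ (fun i => l i ^ 2) hj']
  ring

/-- Some unselected value has the same (weak) sign as `H(S)`. -/
theorem exists_notMem_Hsum_mul_nonneg {n : ℕ} (l : Fin n → ℝ) {S : Finset (Fin n)}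
    (hS : S ≠ Finset.univ) : ∃ j ∉ S, 0 ≤ Hsum l S * l j := by
  have hne : Sᶜ.Nonempty := by
    rwa [Finset.nonempty_iff_ne_empty, Ne, Finset.compl_eq_empty_iff]
  have hsum : ∑ _i ∈ Sᶜ, (0 : ℝ) ≤ ∑ i ∈ Sᶜ, Hsum l S * l i := by
    rw [← Finset.mul_sum, Finset.sum_const_zero]
    exact mul_self_nonneg (Hsum l S)
  obtain ⟨j, hj, h⟩ := Finset.exists_le_of_sum_le hne hsum
  exact ⟨j, Finset.mem_compl.1 hj, h⟩

theorem exists_insert_not_increasing (n : ℕ) (l : Fin n → ℝ)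
    (S : Finset (Fin n)) (hS : S ≠ Finset.univ) :
    ∃ j ∉ S, Fobj l (insert j S) ≤ Fobj l S := by
  obtain ⟨j, hj, h⟩ := exists_notMem_Hsum_mul_nonneg l hS
  refine ⟨j, hj, ?_⟩
  rw [Fobj_insert l hj]
  linarith
end

section
/- Let n ∈ ℕ, k ≤ n, and let λ : Fin n → ℝ with λ_i ≠ 0 for all i. Then there exists a subset S ⊆ Fin n with |S| = k such that F(S) ≤ F(T) for every subset T ⊆ Fin n with |T| = k, and S consists of the largest positive values and the smallest negative values: for all i ∈ S and j ∉ S, if λ_i > 0 and λ_j > 0 then λ_j ≤ λ_i, and if λ_i < 0 and λ_j < 0 then λ_i ≤ λ_j. -/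
open BigOperators

theorem Fobj_neg {n : ℕ} (l : Fin n → ℝ) (S : Finset (Fin n)) :
    Fobj (fun i => -l i) S = Fobj l S := by
  simp [Fobj, Hsum]

theorem card_insert_erase {α : Type*} [DecidableEq α] {S : Finset α} {i j : α}
    (hi : i ∈ S) (hj : j ∉ S) : (insert j (S.erase i)).card = S.card := by
  rw [Finset.card_insert_of_notMem (fun h => hj (Finset.mem_of_mem_erase h)),
    Finset.card_erase_add_one hi]

theorem sum_compl_insert_erase {α : Type*} [Fintype α] [DecidableEq α] (f : α → ℝ)
    {S : Finset α} {i j : α} (hi : i ∈ S) (hj : j ∉ S) :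
    ∑ x ∈ (insert j (S.erase i))ᶜ, f x = ∑ x ∈ Sᶜ, f x + f i - f j := by
  have hT := Finset.sum_add_sum_compl (insert j (S.erase i)) f
  have hS := Finset.sum_add_sum_compl S f
  rw [Finset.sum_insert (fun h => hj (Finset.mem_of_mem_erase h))] at hT
  have hE := Finset.add_sum_erase S f hi
  linarith

/-- Swapping a selected index `i` for an unselected index `j` changes the objective by
`2 (λ_i - λ_j) (H(S) + λ_i)`. -/
theorem Fobj_insert_erase {n : ℕ} (l : Fin n → ℝ) {S : Finset (Fin n)} {i j : Fin n}
    (hi : i ∈ S) (hj : j ∉ S) :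
    Fobj l (insert j (S.erase i)) = Fobj l S + 2 * (l i - l j) * (Hsum l S + l i) := by
  simp only [Fobj, Hsum, sum_compl_insert_erase _ hi hj]
  ring

/-- If `S` minimizes the objective and, among minimizers, the sum of the unselected squares, then
a positive selected value dominates every unselected value. -/
theorem le_of_optimal_of_pos {n : ℕ} {l : Fin n → ℝ} {S : Finset (Fin n)}
    (hopt : ∀ T : Finset (Fin n), T.card = S.card → Fobj l S ≤ Fobj l T)
    (hsq : ∀ T : Finset (Fin n), T.card = S.card → Fobj l T = Fobj l S →
      ∑ i ∈ Sᶜ, l i ^ 2 ≤ ∑ i ∈ Tᶜ, l i ^ 2)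
    {i j : Fin n} (hi : i ∈ S) (hj : j ∉ S) (hpos : 0 < l i) : l j ≤ l i := by
  by_contra! hlt
  have hswap : ∀ r ∉ S, 0 ≤ (l i - l r) * (Hsum l S + l i) := fun r hr => by
    have h := hopt _ (card_insert_erase hi hr)
    rw [Fobj_insert_erase l hi hr] at h
    linarith
  have hle : Hsum l S + l i ≤ 0 := by
    by_contra! h
    nlinarith [hswap j hj]
  rcases hle.eq_or_lt with hzero | hneg
  · have h := hsq _ (card_insert_erase hi hj) (by rw [Fobj_insert_erase l hi hj, hzero]; ring)
    rw [sum_compl_insert_erase _ hi hj] at h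
    nlinarith
  · obtain ⟨r, hr, hrneg⟩ : ∃ r ∈ Sᶜ, l r < 0 := by
      by_contra! h
      have : 0 ≤ Hsum l S := Finset.sum_nonneg h
      linarith
    nlinarith [hswap r (Finset.mem_compl.1 hr)]

theorem exists_optimal_selection (n k : ℕ) (hk : k ≤ n)
    (l : Fin n → ℝ) (hl : ∀ i, l i ≠ 0) :
    ∃ S : Finset (Fin n), S.card = k ∧
      (∀ T : Finset (Fin n), T.card = k → Fobj l S ≤ Fobj l T) ∧
      (∀ i ∈ S, ∀ j ∉ S,
        (0 < l i → 0 < l j → l j ≤ l i) ∧ (l i < 0 → l j < 0 → l i ≤ l j)) := by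
  classical
  obtain ⟨S₀, hS₀, hmin⟩ := Finset.exists_min_image
    (Finset.powersetCard k (Finset.univ : Finset (Fin n))) (Fobj l)
    (Finset.powersetCard_nonempty.2 (by simpa using hk))
  obtain ⟨S, hS, htie⟩ := Finset.exists_min_image
    ((Finset.powersetCard k (Finset.univ : Finset (Fin n))).filter fun T => Fobj l T = Fobj l S₀)
    (fun T => ∑ i ∈ Tᶜ, l i ^ 2) ⟨S₀, by simpa using hS₀⟩
  simp only [Finset.mem_filter, Finset.mem_powersetCard_univ] at hS htie hmin
  obtain ⟨hcard, hFS⟩ := hS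
  have hopt : ∀ T : Finset (Fin n), T.card = S.card → Fobj l S ≤ Fobj l T := fun T hT =>
    hFS ▸ hmin T (hT.trans hcard)
  have hsq : ∀ T : Finset (Fin n), T.card = S.card → Fobj l T = Fobj l S →
      ∑ i ∈ Sᶜ, l i ^ 2 ≤ ∑ i ∈ Tᶜ, l i ^ 2 := fun T hT hF =>
    htie T ⟨hT.trans hcard, hF.trans hFS⟩
  refine ⟨S, hcard, fun T hT => hopt T (hT.trans hcard.symm), fun i hi j hj =>
    ⟨fun hpos _ => le_of_optimal_of_pos hopt hsq hi hj hpos, fun hneg _ => ?_⟩⟩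
  have h := le_of_optimal_of_pos (l := fun i => -l i) (S := S)
    (by simpa only [Fobj_neg] using hopt) (by simpa only [Fobj_neg, neg_sq] using hsq)
    hi hj (neg_pos.2 hneg)
  exact neg_le_neg_iff.1 h
end

section
/- Let n ∈ ℕ, λ : Fin n → ℝ, and let S ⊆ Fin n be a finite subset with m := |S|. Define G(S) := Σ_{i ∉ S} (λ i)² + (1/(|S|+1))·(H(S))². Then for any j ∉ S, G(S ∪ {j}) − G(S) ≤ −(2/(m+1))·λ_j·H(S). -/
open BigOperators

/-- `G(S) = Σ_{i∉S} λ_i² + (1/(|S|+1))·(H(S))²`. -/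
noncomputable def Gobj {n : ℕ} (l : Fin n → ℝ) (S : Finset (Fin n)) : ℝ :=
  ∑ i ∈ Sᶜ, (l i) ^ 2 + (1 / ((S.card : ℝ) + 1)) * (Hsum l S) ^ 2

theorem G_insert_diff_le (n : ℕ) (l : Fin n → ℝ) (S : Finset (Fin n))
    (j : Fin n) (hj : j ∉ S) :
    Gobj l (insert j S) - Gobj l S
      ≤ -(2 / ((S.card : ℝ) + 1)) * l j * Hsum l S := by
  have hj' : j ∈ Sᶜ := Finset.mem_compl.mpr hj
  have hH : Hsum l S = l j + Hsum l (insert j S) := by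
    unfold Hsum
    rw [Finset.compl_insert, Finset.add_sum_erase _ _ hj']
  have hQ : ∑ i ∈ Sᶜ, l i ^ 2 = l j ^ 2 + ∑ i ∈ (insert j S)ᶜ, l i ^ 2 := by
    rw [Finset.compl_insert, Finset.add_sum_erase Sᶜ (fun i => l i ^ 2) hj']
  unfold Gobj
  rw [hQ, hH, Finset.card_insert_of_notMem hj]
  push_cast
  generalize Hsum l (insert j S) = h
  generalize l j = a
  have hm : (0 : ℝ) ≤ S.card := Nat.cast_nonneg _
  generalize (S.card : ℝ) = m at hm ⊢
  have h_shrink : 1 / (m + 1 + 1) * h ^ 2 ≤ 1 / (m + 1) * h ^ 2 := by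
    gcongr
    linarith
  have h_inv : 1 / (m + 1) * a ^ 2 ≤ a ^ 2 :=
    mul_le_of_le_one_left (sq_nonneg a) ((div_le_one (by linarith)).mpr (by linarith))
  linear_combination h_shrink + h_inv
end

section
/- For every real σ > 0 and every real r with 0 ≤ r ≤ 4, the definite integral ∫_{−2σ}^{(2−r)·σ} x²·√(4σ² − x²) dx equals σ⁴·[π + 2·arcsin(1 − r/2) + 2·(1 − r/2)·(1 − 2r + r²/2)·√(r·(1 − r/4))]. -/
open Real intervalIntegral

theorem hasDerivAt_sq_mul_sqrt_antideriv {a x : ℝ} (ha : 0 < a) (hx : x ∈ Set.Ioo (-a) a) :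
    HasDerivAt (fun y => y * (2 * y ^ 2 - a ^ 2) * √(a ^ 2 - y ^ 2) / 8
      + a ^ 4 / 8 * arcsin (y / a)) (x ^ 2 * √(a ^ 2 - x ^ 2)) x := by
  have hpos : 0 < a ^ 2 - x ^ 2 := by nlinarith [hx.1, hx.2]
  have hs : 0 < √(a ^ 2 - x ^ 2) := sqrt_pos.2 hpos
  have hsq : √(a ^ 2 - x ^ 2) ^ 2 = a ^ 2 - x ^ 2 := sq_sqrt hpos.le
  have hscale : √(1 - (x / a) ^ 2) = √(a ^ 2 - x ^ 2) / a := by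
    rw [show 1 - (x / a) ^ 2 = (a ^ 2 - x ^ 2) / a ^ 2 by field_simp, sqrt_div hpos.le,
      sqrt_sq ha.le]
  have hlt : x / a < 1 := (div_lt_one ha).2 hx.2
  have hgt : -1 < x / a := by rw [lt_div_iff₀ ha]; linarith [hx.1]
  have hroot : HasDerivAt (fun y => √(a ^ 2 - y ^ 2)) (-(2 * x) / (2 * √(a ^ 2 - x ^ 2))) x := by
    simpa using (((hasDerivAt_id x).pow 2).const_sub (a ^ 2)).sqrt hpos.ne'
  have hpoly : HasDerivAt (fun y => y * (2 * y ^ 2 - a ^ 2)) (6 * x ^ 2 - a ^ 2) x := by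
    refine ((hasDerivAt_id' x).mul
      ((((hasDerivAt_id' x).pow 2).const_mul 2).sub_const (a ^ 2))).congr_deriv ?_
    norm_num
    ring
  have harcsin : HasDerivAt (fun y => arcsin (y / a)) (1 / √(1 - (x / a) ^ 2) * (1 / a)) x :=
    HasDerivAt.comp (h₂ := arcsin) x (hasDerivAt_arcsin hgt.ne' hlt.ne) ((hasDerivAt_id' x).div_const a)
  refine (((hpoly.mul hroot).div_const 8).add (harcsin.const_mul (a ^ 4 / 8))).congr_deriv ?_
  rw [hscale]
  generalize √(a ^ 2 - x ^ 2) = s at *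
  field_simp
  rw [hsq]
  ring

theorem integral_sq_mul_sqrt_sq_sub_sq {a b : ℝ} (ha : 0 < a) (hab : -a ≤ b) (hba : b ≤ a) :
    ∫ x in (-a)..b, x ^ 2 * √(a ^ 2 - x ^ 2)
      = b * (2 * b ^ 2 - a ^ 2) * √(a ^ 2 - b ^ 2) / 8 + a ^ 4 / 8 * (arcsin (b / a) + π / 2) := by
  rw [integral_eq_sub_of_hasDerivAt_of_le hab (Continuous.continuousOn (by fun_prop))
    (fun x hx => hasDerivAt_sq_mul_sqrt_antideriv ha ⟨hx.1, hx.2.trans_le hba⟩)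
    (Continuous.intervalIntegrable (by fun_prop) _ _)]
  simp only [neg_sq, sub_self, sqrt_zero, neg_div, div_self ha.ne', arcsin_neg, arcsin_one]
  ring

theorem semicircle_second_moment_integral (σ r : ℝ) (hσ : 0 < σ)
    (hr0 : 0 ≤ r) (hr4 : r ≤ 4) :
    ∫ x in (-(2 * σ))..((2 - r) * σ), x ^ 2 * Real.sqrt (4 * σ ^ 2 - x ^ 2)
      = σ ^ 4 * (π + 2 * Real.arcsin (1 - r / 2)
          + 2 * (1 - r / 2) * (1 - 2 * r + r ^ 2 / 2) * Real.sqrt (r * (1 - r / 4))) := by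
  have h := integral_sq_mul_sqrt_sq_sub_sq (a := 2 * σ) (b := (2 - r) * σ) (by positivity)
    (by nlinarith) (by nlinarith)
  have hroot : √((2 * σ) ^ 2 - ((2 - r) * σ) ^ 2) = 2 * σ * √(r * (1 - r / 4)) := by
    rw [show (2 * σ) ^ 2 - ((2 - r) * σ) ^ 2 = (2 * σ) ^ 2 * (r * (1 - r / 4)) by ring,
      sqrt_mul (sq_nonneg _), sqrt_sq (by positivity)]
  have harg : (2 - r) * σ / (2 * σ) = 1 - r / 2 := by field_simp
  rw [hroot, harg] at h
  rw [show 4 * σ ^ 2 = (2 * σ) ^ 2 by ring, h]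
  ring
end
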